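/- For every k ∈ ℝ, λ₀(k) ∈ [2/3, 1], λ₁(k) ∈ [−1, −2/3], and λ₂(k) ∈ [−1/3, 1/3]. Moreover, the set {λ ∈ ℝ : there exists k ∈ ℝ with 9λ³ − 7λ − 2cos k = 0} equals [−1, −2/3] ∪ [−1/3, 1/3] ∪ [2/3, 1]. -/

import Mathlib

noncomputable section

/-- The constant `A = 9√3/(7√7)`. -/
def Aconst : ℝ := 9 * Real.sqrt 3 / (7 * Real.sqrt 7)

/-- `ξ_j(k) = (1/3)·arccos(A·cos k) + 2jπ/3`. -/
def xi (j : ℕ) (k : ℝ) : ℝ :=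
  (1 / 3) * Real.arccos (Aconst * Real.cos k) + 2 * j * Real.pi / 3

/-- `λ_j(k) = (2√7/(3√3))·cos(ξ_j(k))`, the three roots of `9λ³ − 7λ − 2cos k = 0`. -/
def lam (j : ℕ) (k : ℝ) : ℝ :=
  (2 * Real.sqrt 7 / (3 * Real.sqrt 3)) * Real.cos (xi j k)

/-- `x_{j,l}(k) = (−1)^l · λ_j'(k)/√(1 − λ_j(k)²)`. -/
def xfun (j l : ℕ) (k : ℝ) : ℝ :=
  (-1) ^ l * deriv (lam j) k / Real.sqrt (1 - lam j k ^ 2)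

/-- The amplitude `2√7/(3√3)` squares to `28/27`. -/
theorem amplitude_sq : (2 * Real.sqrt 7 / (3 * Real.sqrt 3)) ^ 2 = 28 / 27 := by
  rw [div_pow, mul_pow, mul_pow, Real.sq_sqrt (by norm_num), Real.sq_sqrt (by norm_num)]
  norm_num

theorem one_le_amplitude : 1 ≤ 2 * Real.sqrt 7 / (3 * Real.sqrt 3) := by
  have h0 : 0 ≤ 2 * Real.sqrt 7 / (3 * Real.sqrt 3) := by positivity
  nlinarith [amplitude_sq]

theorem amplitude_lt : 2 * Real.sqrt 7 / (3 * Real.sqrt 3) < 4 / 3 := by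
  nlinarith [amplitude_sq]

theorem amplitude_mul_Aconst : 7 / 3 * (2 * Real.sqrt 7 / (3 * Real.sqrt 3)) * Aconst = 2 := by
  have h7 : Real.sqrt 7 ≠ 0 := by positivity
  have h3 : Real.sqrt 3 ≠ 0 := by positivity
  unfold Aconst
  field_simp
  norm_num

theorem Aconst_nonneg : 0 ≤ Aconst := by
  unfold Aconst
  positivity

theorem Aconst_le_one : Aconst ≤ 1 := by
  nlinarith [amplitude_mul_Aconst, one_le_amplitude, Aconst_nonneg]

theorem abs_Aconst_mul_cos_le (k : ℝ) : |Aconst * Real.cos k| ≤ 1 := by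
  rw [abs_mul, abs_of_nonneg Aconst_nonneg]
  exact mul_le_one₀ Aconst_le_one (abs_nonneg _) (Real.abs_cos_le_one k)

theorem cos_three_mul_xi (j : ℕ) (k : ℝ) : Real.cos (3 * xi j k) = Aconst * Real.cos k := by
  have h := abs_le.mp (abs_Aconst_mul_cos_le k)
  have e : 3 * xi j k = Real.arccos (Aconst * Real.cos k) + j * (2 * Real.pi) := by
    unfold xi
    ring
  rw [e, Real.cos_add_nat_mul_two_pi, Real.cos_arccos h.1 h.2]

/-- Every `λ_j(k)` is a root of the cubic. -/
theorem lam_cubic (j : ℕ) (k : ℝ) : 9 * lam j k ^ 3 - 7 * lam j k = 2 * Real.cos k := by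
  have h := cos_three_mul_xi j k
  rw [Real.cos_three_mul] at h
  unfold lam
  linear_combination
    (9 * (2 * Real.sqrt 7 / (3 * Real.sqrt 3)) * Real.cos (xi j k) ^ 3) * amplitude_sq +
      7 / 3 * (2 * Real.sqrt 7 / (3 * Real.sqrt 3)) * h + Real.cos k * amplitude_mul_Aconst

theorem half_le_cos {x : ℝ} (h0 : 0 ≤ x) (h1 : x ≤ Real.pi / 3) : 1 / 2 ≤ Real.cos x := by
  rw [← Real.cos_pi_div_three]
  exact Real.cos_le_cos_of_nonneg_of_le_pi h0 (by linarith [Real.pi_pos]) h1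

theorem cos_le_half {x : ℝ} (h0 : Real.pi / 3 ≤ x) (h1 : x ≤ Real.pi) : Real.cos x ≤ 1 / 2 := by
  rw [← Real.cos_pi_div_three]
  exact Real.cos_le_cos_of_nonneg_of_le_pi (by linarith [Real.pi_pos]) h1 h0

theorem half_le_lam_zero (k : ℝ) : 1 / 2 ≤ lam 0 k := by
  have h : 1 / 2 ≤ Real.cos (xi 0 k) := by
    have h0 := Real.arccos_nonneg (Aconst * Real.cos k)
    have h1 := Real.arccos_le_pi (Aconst * Real.cos k)
    apply half_le_cos <;> simp only [xi, Nat.cast_zero] <;> linarith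
  unfold lam
  nlinarith [one_le_amplitude]

theorem lam_one_le_neg_half (k : ℝ) : lam 1 k ≤ -(1 / 2) := by
  have h : Real.cos (xi 1 k) ≤ -(1 / 2) := by
    have h0 := Real.arccos_nonneg (Aconst * Real.cos k)
    have h1 := Real.arccos_le_pi (Aconst * Real.cos k)
    have h2 : 1 / 2 ≤ Real.cos (Real.pi - xi 1 k) := by
      apply half_le_cos <;> simp only [xi, Nat.cast_one] <;> linarith
    rw [Real.cos_pi_sub] at h2
    linarith
  unfold lam
  nlinarith [one_le_amplitude]

theorem abs_lam_two_lt (k : ℝ) : |lam 2 k| < 2 / 3 := by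
  have h0 := Real.arccos_nonneg (Aconst * Real.cos k)
  have h1 := Real.arccos_le_pi (Aconst * Real.cos k)
  have hu : Real.cos (xi 2 k) ≤ 1 / 2 := by
    have h2 : Real.cos (2 * Real.pi - xi 2 k) ≤ 1 / 2 := by
      apply cos_le_half <;> simp only [xi, Nat.cast_ofNat] <;> linarith
    rwa [Real.cos_two_pi_sub] at h2
  have hl : -(1 / 2) ≤ Real.cos (xi 2 k) := by
    have h2 : Real.cos (xi 2 k - Real.pi) ≤ 1 / 2 := by
      apply cos_le_half <;> simp only [xi, Nat.cast_ofNat] <;> linarith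
    rw [Real.cos_sub_pi] at h2
    linarith
  unfold lam
  rw [abs_lt]
  constructor <;> nlinarith [one_le_amplitude, amplitude_lt]

/-- The sublevel set `|9l³ − 7l| ≤ 2` is a union of three intervals. -/
theorem abs_cubic_le_two_iff (l : ℝ) :
    |9 * l ^ 3 - 7 * l| ≤ 2 ↔
      (-1 ≤ l ∧ l ≤ -(2 / 3)) ∨ (-(1 / 3) ≤ l ∧ l ≤ 1 / 3) ∨ (2 / 3 ≤ l ∧ l ≤ 1) := by
  have hp : 9 * l ^ 3 - 7 * l - 2 = (l - 1) * ((3 * l + 1) * (3 * l + 2)) := by ring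
  have hm : 9 * l ^ 3 - 7 * l + 2 = (l + 1) * ((3 * l - 1) * (3 * l - 2)) := by ring
  rw [abs_le]
  constructor
  · rintro ⟨h1, h2⟩
    have a1 : 0 ≤ (l + 1) * ((3 * l - 1) * (3 * l - 2)) := by linarith
    have a2 : (l - 1) * ((3 * l + 1) * (3 * l + 2)) ≤ 0 := by linarith
    have hle : l ≤ 1 := by
      by_contra! h
      have : 0 < (l - 1) * ((3 * l + 1) * (3 * l + 2)) :=
        mul_pos (by linarith) (mul_pos (by linarith) (by linarith))
      linarith
    have hge : -1 ≤ l := by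
      by_contra! h
      have : (l + 1) * ((3 * l - 1) * (3 * l - 2)) < 0 :=
        mul_neg_of_neg_of_pos (by linarith) (mul_pos_of_neg_of_neg (by linarith) (by linarith))
      linarith
    by_cases b1 : l ≤ -(2 / 3)
    · exact Or.inl ⟨hge, b1⟩
    by_cases b2 : 2 / 3 ≤ l
    · exact Or.inr (Or.inr ⟨b2, hle⟩)
    push Not at b1 b2
    refine Or.inr (Or.inl ⟨?_, ?_⟩)
    · by_contra! h
      have : 0 < (l - 1) * ((3 * l + 1) * (3 * l + 2)) :=
        mul_pos_of_neg_of_neg (by linarith) (mul_neg_of_neg_of_pos (by linarith) (by linarith))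
      linarith
    · by_contra! h
      have : (l + 1) * ((3 * l - 1) * (3 * l - 2)) < 0 :=
        mul_neg_of_pos_of_neg (by linarith) (mul_neg_of_pos_of_neg (by linarith) (by linarith))
      linarith
  · intro h
    have a1 : 0 ≤ (l + 1) * ((3 * l - 1) * (3 * l - 2)) := by
      rcases h with h | h | h
      · exact mul_nonneg (by linarith) (mul_nonneg_of_nonpos_of_nonpos (by linarith) (by linarith))
      · exact mul_nonneg (by linarith) (mul_nonneg_of_nonpos_of_nonpos (by linarith) (by linarith))
      · exact mul_nonneg (by linarith) (mul_nonneg (by linarith) (by linarith))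
    have a2 : (l - 1) * ((3 * l + 1) * (3 * l + 2)) ≤ 0 := by
      apply mul_nonpos_of_nonpos_of_nonneg
      · rcases h with h | h | h <;> linarith
      · rcases h with h | h | h
        · exact mul_nonneg_of_nonpos_of_nonpos (by linarith) (by linarith)
        · exact mul_nonneg (by linarith) (by linarith)
        · exact mul_nonneg (by linarith) (by linarith)
    constructor <;> linarith

theorem exists_cubic_eq_two_cos_iff (l : ℝ) :
    (∃ k : ℝ, 9 * l ^ 3 - 7 * l - 2 * Real.cos k = 0) ↔ |9 * l ^ 3 - 7 * l| ≤ 2 := by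
  rw [abs_le]
  constructor
  · rintro ⟨k, hk⟩
    constructor <;> linarith [Real.neg_one_le_cos k, Real.cos_le_one k]
  · rintro ⟨h1, h2⟩
    refine ⟨Real.arccos ((9 * l ^ 3 - 7 * l) / 2), ?_⟩
    rw [Real.cos_arccos (by linarith) (by linarith)]
    ring

theorem lam_mem_bands (j : ℕ) (k : ℝ) :
    (-1 ≤ lam j k ∧ lam j k ≤ -(2 / 3)) ∨ (-(1 / 3) ≤ lam j k ∧ lam j k ≤ 1 / 3) ∨
      (2 / 3 ≤ lam j k ∧ lam j k ≤ 1) :=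
  (abs_cubic_le_two_iff _).mp ((exists_cubic_eq_two_cos_iff _).mp
    ⟨k, sub_eq_zero.mpr (lam_cubic j k)⟩)

/-- For every `k`, `λ₀(k) ∈ [2/3, 1]`, `λ₁(k) ∈ [−1, −2/3]`,
`λ₂(k) ∈ [−1/3, 1/3]`; moreover the set of real numbers `λ` solving
`9λ³ − 7λ − 2cos k = 0` for some `k` is
`[−1, −2/3] ∪ [−1/3, 1/3] ∪ [2/3, 1]`. -/
theorem lam_ranges :
    (∀ k : ℝ,
      lam 0 k ∈ Set.Icc (2 / 3 : ℝ) 1 ∧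
      lam 1 k ∈ Set.Icc (-1 : ℝ) (-(2 / 3)) ∧
      lam 2 k ∈ Set.Icc (-(1 / 3) : ℝ) (1 / 3)) ∧
    {l : ℝ | ∃ k : ℝ, 9 * l ^ 3 - 7 * l - 2 * Real.cos k = 0} =
      Set.Icc (-1 : ℝ) (-(2 / 3)) ∪ Set.Icc (-(1 / 3) : ℝ) (1 / 3) ∪
        Set.Icc (2 / 3 : ℝ) 1 := by
  refine ⟨fun k => ⟨?_, ?_, ?_⟩, ?_⟩
  · have h := half_le_lam_zero k
    rcases lam_mem_bands 0 k with b | b | b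
    · linarith
    · linarith
    · exact b
  · have h := lam_one_le_neg_half k
    rcases lam_mem_bands 1 k with b | b | b
    · exact b
    · linarith
    · linarith
  · have h := abs_lt.mp (abs_lam_two_lt k)
    rcases lam_mem_bands 2 k with b | b | b
    · linarith
    · exact b
    · linarith
  · ext l
    simp only [Set.mem_ofPred_eq, Set.mem_union, Set.mem_Icc, or_assoc]
    rw [exists_cubic_eq_two_cos_iff, abs_cubic_le_two_iff]
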